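/- arXiv:2510.01294 — 4 statements merged into one kernel-verified Lean document; each statement's English description precedes it below -/
import Mathlib

section
/- Let G be a finite simple connected graph and let x be a vertex of G that is not a cut vertex. Then gp_t(G - x) ≤ gp_t(G) + deg_G(x). -/
open SimpleGraph

variable {V : Type*}

/-- Two vertices `x` and `y` are `Z`-positionable in `G` if no shortest `x,y`-path
contains a vertex of `Z` as an internal vertex. -/
def ZPositionable (G : SimpleGraph V) (Z : Set V) (x y : V) : Prop :=
  ∀ p : G.Walk x y, p.IsPath → p.length = G.dist x y →
    ∀ z ∈ Z, z ∈ p.support → z = x ∨ z = y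

/-- `Z` is a total general position set of `G`: every pair of vertices of `G`
is `Z`-positionable. -/
def IsTotalGPSet (G : SimpleGraph V) (Z : Set V) : Prop :=
  ∀ x y : V, ZPositionable G Z x y

/-- `Z` is an outer general position set of `G`: every pair of vertices of `Z`
is `Z`-positionable, and every `u ∈ Z`, `v ∉ Z` are `Z`-positionable. -/
def IsOuterGPSet (G : SimpleGraph V) (Z : Set V) : Prop :=
  ∀ x ∈ Z, ∀ y : V, ZPositionable G Z x y

/-- `Z` is a dual general position set of `G`: every pair of vertices of `Z`
is `Z`-positionable, and every pair of vertices outside `Z` is `Z`-positionable. -/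
def IsDualGPSet (G : SimpleGraph V) (Z : Set V) : Prop :=
  (∀ x ∈ Z, ∀ y ∈ Z, ZPositionable G Z x y) ∧
  (∀ x ∉ Z, ∀ y ∉ Z, ZPositionable G Z x y)

/-- The total general position number of `G`. -/
noncomputable def gpt (G : SimpleGraph V) : ℕ :=
  sSup {n | ∃ Z : Set V, IsTotalGPSet G Z ∧ Z.ncard = n}

/-- The outer general position number of `G`. -/
noncomputable def gpo (G : SimpleGraph V) : ℕ :=
  sSup {n | ∃ Z : Set V, IsOuterGPSet G Z ∧ Z.ncard = n}

/-- The dual general position number of `G`. -/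
noncomputable def gpd (G : SimpleGraph V) : ℕ :=
  sSup {n | ∃ Z : Set V, IsDualGPSet G Z ∧ Z.ncard = n}

/-- A vertex `x` is simplicial in `G` if its neighborhood induces a complete subgraph. -/
def IsSimplicial (G : SimpleGraph V) (x : V) : Prop :=
  ∀ u v : V, G.Adj x u → G.Adj x v → u ≠ v → G.Adj u v

/-- `u` is maximally distant from `v` in `G`. -/
def MaxDistantFrom (G : SimpleGraph V) (u v : V) : Prop :=
  ∀ w : V, G.Adj u w → G.dist w v ≤ G.dist u v

/-- `u` and `v` are mutually maximally distant (MMD) in `G`. -/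
def MutuallyMaximallyDistant (G : SimpleGraph V) (u v : V) : Prop :=
  MaxDistantFrom G u v ∧ MaxDistantFrom G v u

theorem IsSimplicial.of_isTotalGPSet {G : SimpleGraph V} {Z : Set V} (h : IsTotalGPSet G Z)
    {z : V} (hz : z ∈ Z) : IsSimplicial G z := by
  intro u v hu hv huv
  by_contra hadj
  let p : G.Walk u v := .cons hu.symm (.cons hv .nil)
  have hp : p.IsPath := by
    simp [p, Walk.cons_isPath_iff, hu.ne', hv.ne, huv]
  have hlen : p.length = G.dist u v := by
    have h₂ : G.dist u v ≤ 2 := dist_le p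
    have h₀ : G.dist u v ≠ 0 := fun h₀ => huv ((p.reachable.dist_eq_zero_iff).1 h₀)
    have h₁ : G.dist u v ≠ 1 := fun h₁ => hadj (dist_eq_one_iff_adj.1 h₁)
    have : p.length = 2 := rfl
    omega
  rcases h u v p hp hlen z hz (by simp [p]) with rfl | rfl
  · exact G.loopless.irrefl _ hu
  · exact G.loopless.irrefl _ hv

theorem IsTotalGPSet.of_isSimplicial {G : SimpleGraph V} {Z : Set V}
    (h : ∀ z ∈ Z, IsSimplicial G z) : IsTotalGPSet G Z := by
  classical
  intro a b p _ hlen z hz hmem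
  by_contra! hne
  have hsum : (p.takeUntil z hmem).reverse.length + (p.dropUntil z hmem).length = p.length := by
    rw [Walk.length_reverse, ← Walk.length_append, Walk.take_spec]
  revert hsum
  cases (p.takeUntil z hmem).reverse with
  | nil => exact absurd rfl hne.1
  | @cons _ u _ hu q =>
    cases p.dropUntil z hmem with
    | nil => exact absurd rfl hne.2
    | @cons _ v _ hv r =>
      intro hsum
      by_cases huv : u = v
      · subst huv
        have := dist_le (q.reverse.append r)
        simp only [Walk.length_append, Walk.length_reverse, Walk.length_cons] at this hsum
        omega
      · have := dist_le (q.reverse.append (.cons (h z hz u v hu hv huv) r))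
        simp only [Walk.length_append, Walk.length_reverse, Walk.length_cons] at this hsum
        omega

theorem isTotalGPSet_iff_forall_isSimplicial {G : SimpleGraph V} {Z : Set V} :
    IsTotalGPSet G Z ↔ ∀ z ∈ Z, IsSimplicial G z :=
  ⟨fun h _ hz => .of_isTotalGPSet h hz, .of_isSimplicial⟩

theorem IsTotalGPSet.ncard_le_gpt [Finite V] {G : SimpleGraph V} {Z : Set V}
    (h : IsTotalGPSet G Z) : Z.ncard ≤ gpt G := by
  refine le_csSup ⟨Nat.card V, ?_⟩ ⟨Z, h, rfl⟩
  rintro _ ⟨Y, _, rfl⟩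
  exact Set.ncard_le_card Y

theorem IsSimplicial.of_induce_ne {G : SimpleGraph V} {x : V} {z : {y : V | y ≠ x}}
    (h : IsSimplicial (G.induce {y : V | y ≠ x}) z) (hz : ¬ G.Adj x z) :
    IsSimplicial G z := by
  intro u v hu hv huv
  have hux : u ≠ x := by rintro rfl; exact hz hu.symm
  have hvx : v ≠ x := by rintro rfl; exact hz hv.symm
  exact h ⟨u, hux⟩ ⟨v, hvx⟩ hu hv (fun e => huv (congrArg Subtype.val e))

/-- If `x` is not a cut vertex of the finite connected graph `G`,
then `gp_t(G - x) ≤ gp_t(G) + deg_G(x)`. -/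
theorem gpt_vertex_removal_upper [Fintype V] (G : SimpleGraph V) [DecidableRel G.Adj]
    (hG : G.Connected) (x : V) (hx : (G.induce {y : V | y ≠ x}).Connected) :
    gpt (G.induce {y : V | y ≠ x}) ≤ gpt G + G.degree x := by
  refine csSup_le ⟨_, ∅, isTotalGPSet_iff_forall_isSimplicial.2 (by simp), rfl⟩ ?_
  rintro _ ⟨Z, hZ, rfl⟩
  have hdiff : IsTotalGPSet G ((Subtype.val '' Z) \ G.neighborSet x) := by
    refine .of_isSimplicial ?_
    rintro _ ⟨⟨z, hz, rfl⟩, hxz⟩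
    exact (IsSimplicial.of_isTotalGPSet hZ hz).of_induce_ne hxz
  calc Z.ncard = (Subtype.val '' Z).ncard :=
        (Set.ncard_image_of_injective Z Subtype.val_injective).symm
    _ ≤ ((Subtype.val '' Z) \ G.neighborSet x).ncard + (G.neighborSet x).ncard :=
        Set.ncard_le_ncard_sdiff_add_ncard _ _
    _ ≤ gpt G + G.degree x := by
        refine Nat.add_le_add hdiff.ncard_le_gpt (le_of_eq ?_)
        rw [Set.ncard_eq_toFinset_card', ← card_neighborFinset_eq_degree, neighborFinset]
end

section
/- Let G be a finite simple graph and let x be a vertex of G. Then s(G) - 1 ≤ s(G - x) ≤ s(G) + deg_G(x), where s(H) denotes the number of simplicial vertices of a graph H. -/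
open SimpleGraph

variable {V : Type*}

/-- The number of simplicial vertices of `G`. -/
noncomputable def simplicialCount (G : SimpleGraph V) : ℕ :=
  {v : V | IsSimplicial G v}.ncard

theorem IsSimplicial.induce {G : SimpleGraph V} {s : Set V} {v : s}
    (h : IsSimplicial G v) : IsSimplicial (G.induce s) v :=
  fun a b ha hb hab => h a b ha hb (Subtype.coe_injective.ne hab)

/-- If the neighborhood of `v` lies in `s`, simpliciality in `G.induce s` lifts to `G`. -/
theorem IsSimplicial.of_induce {G : SimpleGraph V} {s : Set V} {v : s}
    (hs : G.neighborSet v ⊆ s) (h : IsSimplicial (G.induce s) v) : IsSimplicial G v :=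
  fun a b ha hb hab => h ⟨a, hs ha⟩ ⟨b, hs hb⟩ ha hb (fun e => hab (congrArg Subtype.val e))

theorem simplicialCount_induce (G : SimpleGraph V) (s : Set V) :
    simplicialCount (G.induce s) =
      ((↑) '' {v : s | IsSimplicial (G.induce s) v} : Set V).ncard :=
  (Set.ncard_image_of_injective _ Subtype.coe_injective).symm

/-- For a finite graph `G` and a vertex `x`,
`s(G) - 1 ≤ s(G - x) ≤ s(G) + deg_G(x)`. -/
theorem simplicialCount_vertex_removal [Fintype V] (G : SimpleGraph V)
    [DecidableRel G.Adj] (x : V) :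
    simplicialCount G - 1 ≤ simplicialCount (G.induce {y : V | y ≠ x}) ∧
    simplicialCount (G.induce {y : V | y ≠ x}) ≤ simplicialCount G + G.degree x := by
  rw [simplicialCount_induce]
  refine ⟨?_, ?_⟩
  · refine (Set.pred_ncard_le_ncard_sdiff_singleton _ x).trans (Set.ncard_le_ncard ?_)
    rintro v ⟨hv, hvx⟩
    exact ⟨⟨v, hvx⟩, IsSimplicial.induce (s := {y : V | y ≠ x}) hv, rfl⟩
  · rw [← G.card_neighborFinset_eq_degree x, ← Set.ncard_coe_finset]
    refine (Set.ncard_le_ncard ?_).trans (Set.ncard_union_le _ _)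
    rintro _ ⟨v, hv, rfl⟩
    by_cases hvx : G.Adj x v
    · exact Or.inr (by simpa using hvx)
    · refine Or.inl (IsSimplicial.of_induce ?_ hv)
      rintro w hw rfl
      exact hvx hw.symm
end

section
/- Let G be a finite simple connected graph on at least two vertices and let x be a simplicial vertex of G. Then gp_o(G - x) ≤ gp_o(G) + deg_G(x) - 1. -/
open SimpleGraph

variable {V : Type*}

/-- In a connected graph, outer general position is a condition on distances. -/
lemma isOuterGPSet_iff_dist {G : SimpleGraph V} (hG : G.Connected) {Z : Set V} :
    IsOuterGPSet G Z ↔ ∀ u ∈ Z, ∀ z ∈ Z, ∀ y,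
      G.dist u z + G.dist z y = G.dist u y → z = u ∨ z = y := by
  classical
  constructor
  · intro h u hu z hz y hd
    obtain ⟨p, hp⟩ := hG.exists_walk_length_eq_dist u z
    obtain ⟨q, hq⟩ := hG.exists_walk_length_eq_dist z y
    have hl : (p.append q).length = G.dist u y := by
      rw [Walk.length_append, hp, hq, hd]
    exact h u hu y (p.append q) ((p.append q).isPath_of_length_eq_dist hl) hl z hz
      (by simp [Walk.mem_support_append_iff])
  · intro h u hu y p _ hl z hz hmem
    apply h u hu z hz y
    have hsplit : (p.takeUntil z hmem).length + (p.dropUntil z hmem).length = p.length := by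
      rw [← Walk.length_append, Walk.take_spec]
    have h₁ := dist_le (p.takeUntil z hmem)
    have h₂ := dist_le (p.dropUntil z hmem)
    have h₃ := hG.dist_triangle (u := u) (v := z) (w := y)
    omega

lemma SimpleGraph.Connected.exists_adj_dist_add_one {G : SimpleGraph V} (hG : G.Connected)
    {x a : V} (hxa : x ≠ a) : ∃ w, G.Adj x w ∧ G.dist w a + 1 = G.dist x a := by
  obtain ⟨p, hp⟩ := hG.exists_walk_length_eq_dist x a
  cases p with
  | nil => exact absurd rfl hxa
  | @cons _ w _ hadj q =>
    refine ⟨_, hadj, ?_⟩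
    have h₁ := dist_le q
    have h₂ := hG.dist_triangle (u := x) (v := w) (w := a)
    rw [dist_eq_one_iff_adj.mpr hadj] at h₂
    rw [Walk.length_cons] at hp
    omega

/-- A map sending adjacent vertices to equal or adjacent vertices does not lengthen walks. -/
lemma SimpleGraph.Walk.exists_length_le_of_adj_imp {W : Type*} {G : SimpleGraph V}
    {H : SimpleGraph W} (f : V → W) (hf : ∀ u v, G.Adj u v → f u = f v ∨ H.Adj (f u) (f v))
    {a b : V} (p : G.Walk a b) : ∃ q : H.Walk (f a) (f b), q.length ≤ p.length := by
  induction p with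
  | nil => exact ⟨Walk.nil, le_rfl⟩
  | cons h p ih =>
    obtain ⟨q, hq⟩ := ih
    rcases hf _ _ h with he | hadj
    · exact ⟨q.copy he.symm rfl, by simp; omega⟩
    · exact ⟨Walk.cons hadj q, by simpa using hq⟩

/-- Deleting a simplicial vertex does not lengthen walks between the remaining vertices. -/
lemma IsSimplicial.exists_walk_induce {G : SimpleGraph V} {x n : V} (hx : IsSimplicial G x)
    (hn : G.Adj x n) {a b : {y : V | y ≠ x}} (p : G.Walk (a : V) b) :
    ∃ q : (G.induce {y : V | y ≠ x}).Walk a b, q.length ≤ p.length := by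
  classical
  let f : V → {y : V | y ≠ x} := fun v ↦ if h : v = x then ⟨n, hn.ne'⟩ else ⟨v, h⟩
  have hfx : f x = ⟨n, hn.ne'⟩ := by simp [f]
  have hf_ne (v : V) (h : v ≠ x) : f v = ⟨v, h⟩ := by simp [f, h]
  obtain ⟨q, hq⟩ := p.exists_length_le_of_adj_imp (H := G.induce {y : V | y ≠ x}) f (by
    intro u v huv
    by_cases hu : u = x
    · subst hu
      rw [hfx, hf_ne v huv.ne']
      by_cases hnv : n = v
      · exact Or.inl (Subtype.ext hnv)
      · exact Or.inr (hx n v hn huv hnv)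
    · by_cases hv : v = x
      · subst hv
        rw [hfx, hf_ne u hu]
        by_cases hun : u = n
        · exact Or.inl (Subtype.ext hun)
        · exact Or.inr (hx u n huv.symm hn hun)
      · rw [hf_ne u hu, hf_ne v hv]
        exact Or.inr huv)
  exact ⟨q.copy (hf_ne a a.2) (hf_ne b b.2), by simpa using hq⟩

lemma IsSimplicial.connected_induce {G : SimpleGraph V} {x n : V} (hx : IsSimplicial G x)
    (hG : G.Connected) (hn : G.Adj x n) : (G.induce {y : V | y ≠ x}).Connected where
  preconnected a b := by
    obtain ⟨p⟩ := hG.preconnected (a : V) b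
    obtain ⟨q, -⟩ := hx.exists_walk_induce hn p
    exact ⟨q⟩
  nonempty := ⟨⟨n, hn.ne'⟩⟩

/-- The graph obtained by deleting a simplicial vertex is an isometric subgraph. -/
lemma IsSimplicial.dist_induce {G : SimpleGraph V} {x n : V} (hx : IsSimplicial G x)
    (hG : G.Connected) (hn : G.Adj x n) (a b : {y : V | y ≠ x}) :
    (G.induce {y : V | y ≠ x}).dist a b = G.dist (a : V) b := by
  apply le_antisymm
  · obtain ⟨p, hp⟩ := hG.exists_walk_length_eq_dist (a : V) b
    obtain ⟨q, hq⟩ := hx.exists_walk_induce hn p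
    exact (dist_le q).trans (hq.trans hp.le)
  · obtain ⟨q, hq⟩ := (hx.connected_induce hG hn).exists_walk_length_eq_dist a b
    rw [← hq, ← Walk.length_map (Embedding.induce {y : V | y ≠ x}).toHom q]
    exact dist_le _

/-- A simplicial vertex is never internal to a geodesic. -/
lemma IsSimplicial.eq_of_dist_add {G : SimpleGraph V} {x : V} (hx : IsSimplicial G x)
    (hG : G.Connected) {u y : V} (h : G.dist u x + G.dist x y = G.dist u y) :
    x = u ∨ x = y := by
  by_contra! hne
  obtain ⟨n, hn, hnu⟩ := hG.exists_adj_dist_add_one hne.1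
  obtain ⟨m, hm, hmy⟩ := hG.exists_adj_dist_add_one hne.2
  have hnm : G.dist n m ≤ 1 := by
    by_cases he : n = m
    · simp [he]
    · exact (dist_eq_one_iff_adj.mpr (hx n m hn hm he)).le
  have h₁ := hG.dist_triangle (u := u) (v := n) (w := y)
  have h₂ := hG.dist_triangle (u := n) (v := m) (w := y)
  rw [G.dist_comm (u := n) (v := u), G.dist_comm (u := x) (v := u)] at hnu
  omega

/-- If `Z` is an outer general position set of `G - x`, then its vertices not adjacent to the
simplicial vertex `x` form an outer general position set of `G`. -/
lemma IsOuterGPSet.image_diff_neighborSet {G : SimpleGraph V} {x n : V} (hx : IsSimplicial G x)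
    (hG : G.Connected) (hn : G.Adj x n) {Z : Set {y : V | y ≠ x}}
    (hZ : IsOuterGPSet (G.induce {y : V | y ≠ x}) Z) :
    IsOuterGPSet G (Subtype.val '' Z \ G.neighborSet x) := by
  rw [isOuterGPSet_iff_dist (hx.connected_induce hG hn)] at hZ
  simp only [hx.dist_induce hG hn] at hZ
  rw [isOuterGPSet_iff_dist hG]
  rintro _ ⟨⟨u, hu, rfl⟩, -⟩ _ ⟨⟨z, hz, rfl⟩, hzN⟩ y hd
  by_cases hy : y = x
  · subst hy
    obtain ⟨w, hw, hwz⟩ := hG.exists_adj_dist_add_one z.2.symm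
    have h₁ := hG.dist_triangle (u := (u : V)) (v := w) (w := y)
    have h₂ := hG.dist_triangle (u := (u : V)) (v := z) (w := w)
    rw [dist_eq_one_iff_adj.mpr hw.symm] at h₁
    rw [G.dist_comm (u := w), G.dist_comm (u := y)] at hwz
    rcases hZ u hu z hz ⟨w, hw.ne'⟩ (by dsimp only; omega) with h | h
    · exact Or.inl (congrArg Subtype.val h)
    · exact absurd (by simpa [h] using hw) hzN
  · exact (hZ u hu z hz ⟨y, hy⟩ hd).imp (congrArg Subtype.val) (congrArg Subtype.val)

/-- If an outer general position set of `G - x` contains all neighbors of the simplicial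
vertex `x`, then they can be exchanged for `x`. -/
lemma IsOuterGPSet.insert_image_diff_neighborSet {G : SimpleGraph V} {x n : V}
    (hx : IsSimplicial G x) (hG : G.Connected) (hn : G.Adj x n) {Z : Set {y : V | y ≠ x}}
    (hZ : IsOuterGPSet (G.induce {y : V | y ≠ x}) Z)
    (hN : G.neighborSet x ⊆ Subtype.val '' Z) :
    IsOuterGPSet G (insert x (Subtype.val '' Z \ G.neighborSet x)) := by
  have hdiff := (isOuterGPSet_iff_dist hG).mp (hZ.image_diff_neighborSet hx hG hn)
  rw [isOuterGPSet_iff_dist (hx.connected_induce hG hn)] at hZ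
  simp only [hx.dist_induce hG hn] at hZ
  rw [isOuterGPSet_iff_dist hG]
  intro u hu z hz y hd
  rcases Set.mem_insert_iff.mp hz with rfl | hzZ
  · exact hx.eq_of_dist_add hG hd
  rcases Set.mem_insert_iff.mp hu with rfl | huZ
  · obtain ⟨⟨z, hzZ, rfl⟩, hzN⟩ := hzZ
    obtain ⟨w, hw, hwz⟩ := hG.exists_adj_dist_add_one z.2.symm
    obtain ⟨w, hwZ, rfl⟩ := hN hw
    have hy : y ≠ u := by
      rintro rfl
      rw [dist_self] at hd
      omega
    have h₁ := hG.dist_triangle (u := u) (v := (w : V)) (w := y)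
    have h₂ := hG.dist_triangle (u := (w : V)) (v := z) (w := y)
    rw [dist_eq_one_iff_adj.mpr hw] at h₁
    rcases hZ w hwZ z hzZ ⟨y, hy⟩ (by dsimp only; omega) with h | h
    · exact absurd (by simpa [h] using hw) hzN
    · exact Or.inr (congrArg Subtype.val h)
  · exact hdiff u huZ z hzZ y hd

lemma IsOuterGPSet.ncard_le_gpo [Finite V] {G : SimpleGraph V} {Z : Set V}
    (hZ : IsOuterGPSet G Z) : Z.ncard ≤ gpo G :=
  le_csSup ⟨Nat.card V, by rintro _ ⟨Z, -, rfl⟩; exact Set.ncard_le_card Z⟩ ⟨Z, hZ, rfl⟩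

lemma gpo_le {G : SimpleGraph V} {b : ℕ} (h : ∀ Z, IsOuterGPSet G Z → Z.ncard ≤ b) :
    gpo G ≤ b :=
  csSup_le ⟨_, ∅, by simp [IsOuterGPSet], rfl⟩ (by rintro _ ⟨Z, hZ, rfl⟩; exact h Z hZ)

/-- If `x` is a simplicial vertex of the finite connected graph `G`
on at least two vertices, then `gp_o(G - x) ≤ gp_o(G) + deg_G(x) - 1`. -/
theorem gpo_vertex_removal_simplicial [Fintype V] [Nontrivial V]
    (G : SimpleGraph V) [DecidableRel G.Adj] (hG : G.Connected)
    (x : V) (hx : IsSimplicial G x) :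
    gpo (G.induce {y : V | y ≠ x}) ≤ gpo G + G.degree x - 1 := by
  obtain ⟨n, hn⟩ := hG.preconnected.exists_adj_of_nontrivial x
  refine gpo_le fun Z hZ ↦ ?_
  have hdeg : (G.neighborSet x).ncard = G.degree x := by
    rw [Set.ncard_eq_toFinset_card', ← card_neighborSet_eq_degree, Set.toFinset_card]
  have hsplit := Set.ncard_inter_add_ncard_sdiff_eq_ncard (Subtype.val '' Z) (G.neighborSet x)
  rw [Set.ncard_image_of_injective Z Subtype.val_injective] at hsplit
  by_cases hN : G.neighborSet x ⊆ Subtype.val '' Z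
  · have hle := (hZ.insert_image_diff_neighborSet hx hG hn hN).ncard_le_gpo
    rw [Set.ncard_insert_of_notMem (by simp)] at hle
    rw [Set.inter_eq_self_of_subset_right hN] at hsplit
    omega
  · have hle := (hZ.image_diff_neighborSet hx hG hn).ncard_le_gpo
    have hlt : (Subtype.val '' Z ∩ G.neighborSet x).ncard < (G.neighborSet x).ncard :=
      Set.ncard_lt_ncard (Set.inter_ssubset_right_iff.mpr hN)
    omega
end

section
/- Let G be a finite simple connected graph and let x be a vertex of G that is not a cut vertex and lies in some gp_d-set of G (i.e., in some dual general position set of maximum cardinality). Then gp_d(G) - 1 ≤ gp_d(G - x). -/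
open SimpleGraph

variable {V : Type*}

/-- Two vertices of `G - x` that are `Z`-positionable in the connected graph `G`, where `x ∈ Z`,
are `Z`-positionable in `G - x`. -/
theorem ZPositionable.induce_ne {G : SimpleGraph V} (hG : G.Connected) {Z : Set V} {x : V}
    (hxZ : x ∈ Z) {u v : {y : V | y ≠ x}} (h : ZPositionable G Z u v) :
    ZPositionable (G.induce {y : V | y ≠ x}) (Subtype.val ⁻¹' Z) u v := by
  intro p hp hlen z hz hzp
  obtain ⟨q, hq, hqlen⟩ := hG.exists_path_of_dist (u : V) v
  have hxq : ∀ w ∈ q.support, w ∈ {y : V | y ≠ x} := by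
    rintro w hw rfl
    rcases h q hq hqlen w hxZ hw with hu | hv
    · exact u.2 hu.symm
    · exact v.2 hv.symm
  let f := (Embedding.induce (G := G) {y : V | y ≠ x}).toHom
  have hle : (G.induce {y : V | y ≠ x}).dist u v ≤ G.dist (u : V) v := by
    have hlength : (q.induce _ hxq).length = q.length :=
      (Walk.length_map f _).symm.trans (congrArg Walk.length (q.map_induce hxq))
    exact (dist_le (q.induce _ hxq)).trans (hlength.trans hqlen).le
  have hge : G.dist (u : V) v ≤ (p.map f).length := dist_le _
  have hpath : (p.map f).IsPath := hp.map Subtype.val_injective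
  have hmem : (z : V) ∈ (p.map f).support := by
    rw [Walk.support_map]
    exact List.mem_map_of_mem hzp
  have hmaplen : (p.map f).length ≤ G.dist (u : V) v :=
    ((p.length_map f).trans hlen).le.trans hle
  exact (h (p.map f) hpath (hmaplen.antisymm hge) z hz hmem).imp Subtype.ext Subtype.ext

/-- Removing a vertex `x` of a dual general position set `X` leaves a dual general position set
of `G - x`. -/
theorem IsDualGPSet.induce_ne {G : SimpleGraph V} (hG : G.Connected) {X : Set V} {x : V}
    (hX : IsDualGPSet G X) (hxX : x ∈ X) :
    IsDualGPSet (G.induce {y : V | y ≠ x}) (Subtype.val ⁻¹' X) :=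
  ⟨fun u hu v hv => (hX.1 u hu v hv).induce_ne hG hxX,
    fun u hu v hv => (hX.2 u hu v hv).induce_ne hG hxX⟩

theorem IsDualGPSet.ncard_le_gpd [Finite V] {G : SimpleGraph V} {Z : Set V}
    (hZ : IsDualGPSet G Z) : Z.ncard ≤ gpd G := by
  refine le_csSup ⟨Nat.card V, ?_⟩ ⟨Z, hZ, rfl⟩
  rintro n ⟨Y, -, rfl⟩
  exact Set.ncard_le_card Y

/-- If `x` is not a cut vertex of the finite connected graph `G`
and `x` lies in some gp_d-set of `G`, then `gp_d(G) - 1 ≤ gp_d(G - x)`. -/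
theorem gpd_vertex_removal_lower [Fintype V] (G : SimpleGraph V) (hG : G.Connected)
    (x : V) (hx : (G.induce {y : V | y ≠ x}).Connected)
    (X : Set V) (hX : IsDualGPSet G X) (hXcard : X.ncard = gpd G) (hxX : x ∈ X) :
    gpd G - 1 ≤ gpd (G.induce {y : V | y ≠ x}) := by
  have himage : Subtype.val '' (Subtype.val ⁻¹' X : Set {y : V | y ≠ x}) = X \ {x} := by
    rw [Subtype.image_preimage_coe, Set.inter_comm]
    rfl
  rw [← hXcard, ← Set.ncard_sdiff_singleton_of_mem hxX, ← himage,
    Set.ncard_image_of_injective _ Subtype.val_injective]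
  exact (hX.induce_ne hG hxX).ncard_le_gpd
end
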